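/- Let α ∈ (0,1), let E₁, E₂ be quantum channels on n×n complex matrices and C₁, C₂ quantum channels on m×m complex matrices. For channels E with Kraus family (K_i) and C with Kraus family (L_j), let E ⊗ C denote the quantum channel on (nm)×(nm) matrices (indexed by Fin n × Fin m) with Kraus family (K_i ⊗ L_j), so that (E ⊗ C)(X ⊗ Y) = E(X) ⊗ C(Y). Then the channel α-fidelity is supermultiplicative in the sense that 𝓕_α(E₁ ⊗ C₁, E₂ ⊗ C₂) ≤ 𝓕_α(E₁, E₂) · 𝓕_α(C₁, C₂). -/

import Mathlib

open Matrix
open scoped Kronecker ComplexOrder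

/-- Real power of a (Hermitian) matrix, defined by applying the real power function to the
eigenvalues via the spectral decomposition (functional calculus). -/
noncomputable def mpow {ι : Type*} [Fintype ι] [DecidableEq ι]
    (A : Matrix ι ι ℂ) (t : ℝ) : Matrix ι ι ℂ :=
  if hA : A.IsHermitian then
    (hA.eigenvectorUnitary : Matrix ι ι ℂ) *
      Matrix.diagonal (fun i => ((hA.eigenvalues i ^ t : ℝ) : ℂ)) *
      star (hA.eigenvectorUnitary : Matrix ι ι ℂ)
  else 0

/-- The α-fidelity `F_α(ρ,σ) = tr[(σ^((1−α)/(2α)) ρ σ^((1−α)/(2α)))^α]`. -/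
noncomputable def aFid {ι : Type*} [Fintype ι] [DecidableEq ι]
    (α : ℝ) (ρ σ : Matrix ι ι ℂ) : ℝ :=
  (Matrix.trace (mpow (mpow σ ((1 - α) / (2 * α)) * ρ * mpow σ ((1 - α) / (2 * α))) α)).re

/-- A density matrix: positive semidefinite with trace 1. -/
def IsDensity {ι : Type*} [Fintype ι] (ρ : Matrix ι ι ℂ) : Prop :=
  ρ.PosSemidef ∧ ρ.trace = 1

/-- Partial trace over the second tensor factor. -/
noncomputable def ptrace2 {ι κ : Type*} [Fintype κ]
    (M : Matrix (ι × κ) (ι × κ) ℂ) : Matrix ι ι ℂ :=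
  Matrix.of fun i j => ∑ k : κ, M (i, k) (j, k)

/-- A quantum channel: a map admitting a Kraus representation `E(X) = Σ_i K_i X K_i*`
with `Σ_i K_i* K_i = 1`. -/
def IsQChannel {ι κ : Type*} [Fintype ι] [DecidableEq ι] [Fintype κ] [DecidableEq κ]
    (E : Matrix ι ι ℂ → Matrix κ κ ℂ) : Prop :=
  ∃ (k : ℕ) (K : Fin k → Matrix κ ι ℂ),
    (∀ X, E X = ∑ i, K i * X * (K i)ᴴ) ∧ (∑ i, (K i)ᴴ * K i = 1)

/-- The α-fidelity of channels:
`𝓕_α(E₁,E₂) = inf { F_α(E₁(ρ₁),E₂(ρ₂)) / F_α(ρ₁,ρ₂) }` over density matrices with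
`F_α(ρ₁,ρ₂) > 0`. -/
noncomputable def chanFid {ι κ : Type*} [Fintype ι] [DecidableEq ι] [Fintype κ] [DecidableEq κ]
    (α : ℝ) (E₁ E₂ : Matrix ι ι ℂ → Matrix κ κ ℂ) : ℝ :=
  sInf { r : ℝ | ∃ ρ₁ ρ₂ : Matrix ι ι ℂ, IsDensity ρ₁ ∧ IsDensity ρ₂ ∧
    0 < aFid α ρ₁ ρ₂ ∧ r = aFid α (E₁ ρ₁) (E₂ ρ₂) / aFid α ρ₁ ρ₂ }

section MatrixPower

variable {ι κ : Type*} [Fintype ι] [DecidableEq ι] [Fintype κ] [DecidableEq κ]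

/-- `mpow` may be computed from any unitary diagonalization. -/
lemma mpow_unitary_conj_diagonal {A U : Matrix ι ι ℂ} (hU : U ∈ unitaryGroup ι ℂ) (d : ι → ℝ)
    (hA : A = U * diagonal (fun i => (d i : ℂ)) * star U) (t : ℝ) :
    mpow A t = U * diagonal (fun i => ((d i ^ t : ℝ) : ℂ)) * star U := by
  have hH : A.IsHermitian := by
    rw [hA, star_eq_conjTranspose]
    refine isHermitian_mul_mul_conjTranspose U ?_
    exact isHermitian_diagonal_iff.2 fun i => Complex.conj_ofReal _
  rw [mpow, dif_pos hH]
  set V : Matrix ι ι ℂ := (hH.eigenvectorUnitary : Matrix ι ι ℂ) with hV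
  have hVm : V ∈ unitaryGroup ι ℂ := hH.eigenvectorUnitary.2
  have hVV := mem_unitaryGroup_iff.1 hVm
  have hVV' := mem_unitaryGroup_iff'.1 hVm
  have hUU := mem_unitaryGroup_iff.1 hU
  have hUU' := mem_unitaryGroup_iff'.1 hU
  have hsp : A = V * diagonal (fun i => (hH.eigenvalues i : ℂ)) * star V := by
    conv_lhs => rw [hH.spectral_theorem]
    rfl
  have key : star U * V * diagonal (fun i => (hH.eigenvalues i : ℂ)) =
      diagonal (fun i => (d i : ℂ)) * (star U * V) := by
    calc _ = star U * (V * diagonal (fun i => (hH.eigenvalues i : ℂ)) * (star V * V)) := by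
          rw [hVV', Matrix.mul_one, Matrix.mul_assoc]
      _ = star U * A * V := by
          refine Eq.trans ?_ (congrArg (fun M => star U * M * V) hsp).symm
          simp only [Matrix.mul_assoc]
      _ = (star U * U) * diagonal (fun i => (d i : ℂ)) * (star U * V) := by
          refine (congrArg (fun M => star U * M * V) hA).trans ?_
          simp only [Matrix.mul_assoc]
      _ = _ := by rw [hUU', Matrix.one_mul]
  have key' : star U * V * diagonal (fun i => ((hH.eigenvalues i ^ t : ℝ) : ℂ)) =
      diagonal (fun i => ((d i ^ t : ℝ) : ℂ)) * (star U * V) := by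
    ext i j
    have h := congrFun (congrFun key i) j
    rw [mul_diagonal, diagonal_mul] at h ⊢
    by_cases h0 : (star U * V) i j = 0
    · simp [h0]
    · rw [mul_comm] at h
      have h1 := Complex.ofReal_injective (mul_right_cancel₀ h0 h)
      rw [h1, mul_comm]
  calc _ = (U * star U) * V * diagonal (fun i => ((hH.eigenvalues i ^ t : ℝ) : ℂ)) * star V := by
        rw [hUU, Matrix.one_mul]
    _ = U * (star U * V * diagonal (fun i => ((hH.eigenvalues i ^ t : ℝ) : ℂ))) * star V := by
        simp only [Matrix.mul_assoc]
    _ = U * diagonal (fun i => ((d i ^ t : ℝ) : ℂ)) * star U * (V * star V) := by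
        rw [key']; simp only [Matrix.mul_assoc]
    _ = _ := by rw [hVV, Matrix.mul_one]

/-- A positive semidefinite matrix is unitarily diagonalizable with nonnegative eigenvalues. -/
lemma Matrix.PosSemidef.exists_unitary_diagonal {A : Matrix ι ι ℂ} (hA : A.PosSemidef) :
    ∃ U ∈ unitaryGroup ι ℂ, ∃ d : ι → ℝ, (∀ i, 0 ≤ d i) ∧
      A = U * diagonal (fun i => (d i : ℂ)) * star U := by
  refine ⟨_, hA.isHermitian.eigenvectorUnitary.2, hA.isHermitian.eigenvalues,
    hA.eigenvalues_nonneg, ?_⟩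
  conv_lhs => rw [hA.isHermitian.spectral_theorem]
  rfl

lemma mpow_posSemidef {A : Matrix ι ι ℂ} (hA : A.PosSemidef) (t : ℝ) :
    (mpow A t).PosSemidef := by
  obtain ⟨U, hU, d, hd, h⟩ := hA.exists_unitary_diagonal
  rw [mpow_unitary_conj_diagonal hU d h, star_eq_conjTranspose]
  refine PosSemidef.mul_mul_conjTranspose_same (posSemidef_diagonal_iff.2 fun i => ?_) U
  exact Complex.zero_le_real.2 (Real.rpow_nonneg (hd i) t)

lemma mpow_kronecker {A : Matrix ι ι ℂ} {B : Matrix κ κ ℂ} (hA : A.PosSemidef)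
    (hB : B.PosSemidef) (t : ℝ) : mpow (A ⊗ₖ B) t = mpow A t ⊗ₖ mpow B t := by
  obtain ⟨U, hU, d, hd, h⟩ := hA.exists_unitary_diagonal
  obtain ⟨V, hV, e, he, h'⟩ := hB.exists_unitary_diagonal
  rw [mpow_unitary_conj_diagonal hU d h, mpow_unitary_conj_diagonal hV e h',
    mpow_unitary_conj_diagonal (U := U ⊗ₖ V) (kronecker_mem_unitary hU hV)
      (fun p => d p.1 * e p.2)]
  · simp only [star_eq_conjTranspose, conjTranspose_kronecker, mul_kronecker_mul,
      diagonal_kronecker_diagonal, Real.mul_rpow (hd _) (he _), Complex.ofReal_mul]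
  · rw [h, h']
    simp only [star_eq_conjTranspose, conjTranspose_kronecker, mul_kronecker_mul,
      diagonal_kronecker_diagonal, Complex.ofReal_mul]

lemma mpow_smul_one (c t : ℝ) :
    mpow ((c : ℂ) • (1 : Matrix ι ι ℂ)) t = ((c ^ t : ℝ) : ℂ) • (1 : Matrix ι ι ℂ) := by
  rw [mpow_unitary_conj_diagonal (U := 1) (one_mem _) (fun _ => c)]
  · simp [smul_one_eq_diagonal]
  · simp [smul_one_eq_diagonal]

lemma sandwich_posSemidef {ρ σ : Matrix ι ι ℂ} (hρ : ρ.PosSemidef) (hσ : σ.PosSemidef) (t : ℝ) :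
    (mpow σ t * ρ * mpow σ t).PosSemidef := by
  have h := hρ.mul_mul_conjTranspose_same (mpow σ t)
  rwa [(mpow_posSemidef hσ t).isHermitian.eq] at h

end MatrixPower

section Kraus

variable {ι ι' κ κ' : Type*} [Fintype ι] [Fintype ι']

lemma IsDensity.kronecker {ρ : Matrix ι ι ℂ} {σ : Matrix ι' ι' ℂ} (hρ : IsDensity ρ)
    (hσ : IsDensity σ) : IsDensity (ρ ⊗ₖ σ) :=
  ⟨hρ.1.kronecker hσ.1, by rw [trace_kronecker, hρ.2, hσ.2, one_mul]⟩

lemma sum_kraus_posSemidef [Finite κ] {k : ℕ} (K : Fin k → Matrix κ ι ℂ) {X : Matrix ι ι ℂ}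
    (hX : X.PosSemidef) : (∑ i, K i * X * (K i)ᴴ).PosSemidef :=
  posSemidef_sum _ fun i _ => hX.mul_mul_conjTranspose_same (K i)

lemma sum_kraus_kronecker {k l : ℕ}
    (K : Fin k → Matrix κ ι ℂ) (L : Fin l → Matrix κ' ι' ℂ) (X : Matrix ι ι ℂ)
    (Y : Matrix ι' ι' ℂ) :
    ∑ i, ∑ j, (K i ⊗ₖ L j) * (X ⊗ₖ Y) * (K i ⊗ₖ L j)ᴴ =
      (∑ i, K i * X * (K i)ᴴ) ⊗ₖ (∑ j, L j * Y * (L j)ᴴ) := by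
  simp only [conjTranspose_kronecker, ← mul_kronecker_mul]
  ext ⟨a, b⟩ ⟨c, d⟩
  simp only [Matrix.sum_apply, kronecker_apply, Finset.sum_mul_sum]

end Kraus

section Fidelity

variable {ι κ : Type*} [Fintype ι] [DecidableEq ι] [Fintype κ] [DecidableEq κ]

lemma aFid_nonneg {ρ σ : Matrix ι ι ℂ} (hρ : ρ.PosSemidef) (hσ : σ.PosSemidef) (α : ℝ) :
    0 ≤ aFid α ρ σ :=
  (Complex.le_def.1 (mpow_posSemidef (sandwich_posSemidef hρ hσ _) α).trace_nonneg).1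

lemma aFid_kronecker {ρ σ : Matrix ι ι ℂ} {ρ' σ' : Matrix κ κ ℂ} (hρ : ρ.PosSemidef)
    (hσ : σ.PosSemidef) (hρ' : ρ'.PosSemidef) (hσ' : σ'.PosSemidef) (α : ℝ) :
    aFid α (ρ ⊗ₖ ρ') (σ ⊗ₖ σ') = aFid α ρ σ * aFid α ρ' σ' := by
  have h := (Complex.le_def.1 (mpow_posSemidef
    (sandwich_posSemidef hρ hσ ((1 - α) / (2 * α))) α).trace_nonneg).2
  unfold aFid
  rw [mpow_kronecker hσ hσ', ← mul_kronecker_mul, ← mul_kronecker_mul,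
    mpow_kronecker (sandwich_posSemidef hρ hσ _) (sandwich_posSemidef hρ' hσ' _),
    trace_kronecker, Complex.mul_re, ← h]
  simp

lemma exists_isDensity_aFid_pos [Nonempty ι] (α : ℝ) :
    ∃ ρ : Matrix ι ι ℂ, IsDensity ρ ∧ 0 < aFid α ρ ρ := by
  have hc : 0 < (Fintype.card ι : ℝ) := by exact_mod_cast Fintype.card_pos
  refine ⟨(((Fintype.card ι : ℝ)⁻¹ : ℝ) : ℂ) • 1, ⟨?_, ?_⟩, ?_⟩
  · exact PosSemidef.one.smul (Complex.zero_le_real.2 (by positivity))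
  · rw [trace_smul, trace_one, smul_eq_mul]
    push_cast
    exact inv_mul_cancel₀ (by exact_mod_cast hc.ne')
  · rw [aFid, mpow_smul_one]
    simp only [smul_mul_smul_comm, Matrix.mul_one, ← Complex.ofReal_mul]
    rw [mpow_smul_one, trace_smul, trace_one, smul_eq_mul, ← Complex.ofReal_natCast,
      ← Complex.ofReal_mul, Complex.ofReal_re]
    positivity

lemma chanFid_of_isEmpty [IsEmpty ι] (α : ℝ) (E₁ E₂ : Matrix ι ι ℂ → Matrix κ κ ℂ) :
    chanFid α E₁ E₂ = 0 := by
  rw [chanFid]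
  convert Real.sInf_empty
  refine Set.eq_empty_of_forall_notMem ?_
  rintro r ⟨ρ, _, hρ, _⟩
  simpa [Matrix.trace] using hρ.2

end Fidelity

lemma le_sInf_mul_sInf {A B : Set ℝ} {c : ℝ} (hA : A.Nonempty) (hB : B.Nonempty)
    (hA0 : ∀ a ∈ A, 0 ≤ a) (hB0 : ∀ b ∈ B, 0 ≤ b) (h : ∀ a ∈ A, ∀ b ∈ B, c ≤ a * b) :
    c ≤ sInf A * sInf B := by
  have aux : ∀ {S : Set ℝ} {x : ℝ}, S.Nonempty → 0 ≤ x → (∀ b ∈ S, c ≤ x * b) →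
      c ≤ x * sInf S := by
    intro S x hS hx hc
    rcases hx.eq_or_lt with rfl | hx
    · obtain ⟨b, hb⟩ := hS
      simpa using hc b hb
    · rw [← div_le_iff₀' hx]
      exact le_csInf hS fun b hb => (div_le_iff₀' hx).2 (hc b hb)
  rw [mul_comm]
  refine aux hA (Real.sInf_nonneg hB0) fun a ha => ?_
  rw [mul_comm]
  exact aux hB (hA0 a ha) (h a ha)

/-- the channel α-fidelity is supermultiplicative:
`𝓕_α(E₁ ⊗ C₁, E₂ ⊗ C₂) ≤ 𝓕_α(E₁, E₂) · 𝓕_α(C₁, C₂)`, where the tensor-product channel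
has Kraus operators `K_i ⊗ L_j`. -/
theorem stmt10 {n m : ℕ} (α : ℝ) (hα : 0 < α) (hα' : α < 1)
    (k₁ k₂ l₁ l₂ : ℕ)
    (K₁ : Fin k₁ → Matrix (Fin n) (Fin n) ℂ) (hK₁ : ∑ i, (K₁ i)ᴴ * K₁ i = 1)
    (K₂ : Fin k₂ → Matrix (Fin n) (Fin n) ℂ) (hK₂ : ∑ i, (K₂ i)ᴴ * K₂ i = 1)
    (L₁ : Fin l₁ → Matrix (Fin m) (Fin m) ℂ) (hL₁ : ∑ j, (L₁ j)ᴴ * L₁ j = 1)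
    (L₂ : Fin l₂ → Matrix (Fin m) (Fin m) ℂ) (hL₂ : ∑ j, (L₂ j)ᴴ * L₂ j = 1) :
    chanFid α (fun X => ∑ i, ∑ j, (K₁ i ⊗ₖ L₁ j) * X * (K₁ i ⊗ₖ L₁ j)ᴴ)
              (fun X => ∑ i, ∑ j, (K₂ i ⊗ₖ L₂ j) * X * (K₂ i ⊗ₖ L₂ j)ᴴ) ≤
      chanFid α (fun X => ∑ i, K₁ i * X * (K₁ i)ᴴ) (fun X => ∑ i, K₂ i * X * (K₂ i)ᴴ) *
        chanFid α (fun X => ∑ j, L₁ j * X * (L₁ j)ᴴ) (fun X => ∑ j, L₂ j * X * (L₂ j)ᴴ) := by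
  rcases isEmpty_or_nonempty (Fin n) with hn | hn
  · rw [chanFid_of_isEmpty, chanFid_of_isEmpty, zero_mul]
  rcases isEmpty_or_nonempty (Fin m) with hm | hm
  · rw [chanFid_of_isEmpty, chanFid_of_isEmpty (ι := Fin m), mul_zero]
  refine le_sInf_mul_sInf ?_ ?_ ?_ ?_ ?_
  · obtain ⟨ρ, hρ, h⟩ := exists_isDensity_aFid_pos (ι := Fin n) α
    exact ⟨_, ρ, ρ, hρ, hρ, h, rfl⟩
  · obtain ⟨ρ, hρ, h⟩ := exists_isDensity_aFid_pos (ι := Fin m) α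
    exact ⟨_, ρ, ρ, hρ, hρ, h, rfl⟩
  · rintro _ ⟨ρ, σ, hρ, hσ, h, rfl⟩
    exact div_nonneg
      (aFid_nonneg (sum_kraus_posSemidef K₁ hρ.1) (sum_kraus_posSemidef K₂ hσ.1) α) h.le
  · rintro _ ⟨ρ, σ, hρ, hσ, h, rfl⟩
    exact div_nonneg
      (aFid_nonneg (sum_kraus_posSemidef L₁ hρ.1) (sum_kraus_posSemidef L₂ hσ.1) α) h.le
  · rintro _ ⟨ρ, σ, hρ, hσ, h, rfl⟩ _ ⟨ρ', σ', hρ', hσ', h', rfl⟩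
    refine csInf_le ⟨0, ?_⟩ ⟨ρ ⊗ₖ ρ', σ ⊗ₖ σ', hρ.kronecker hρ', hσ.kronecker hσ', ?_, ?_⟩
    · rintro _ ⟨τ, ω, hτ, hω, hpos, rfl⟩
      refine div_nonneg (aFid_nonneg ?_ ?_ α) hpos.le
      · exact posSemidef_sum _ fun i _ => sum_kraus_posSemidef (fun j => K₁ i ⊗ₖ L₁ j) hτ.1
      · exact posSemidef_sum _ fun i _ => sum_kraus_posSemidef (fun j => K₂ i ⊗ₖ L₂ j) hω.1
    · rw [aFid_kronecker hρ.1 hσ.1 hρ'.1 hσ'.1]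
      exact mul_pos h h'
    · beta_reduce
      rw [aFid_kronecker hρ.1 hσ.1 hρ'.1 hσ'.1, sum_kraus_kronecker, sum_kraus_kronecker,
        aFid_kronecker (sum_kraus_posSemidef K₁ hρ.1) (sum_kraus_posSemidef K₂ hσ.1)
          (sum_kraus_posSemidef L₁ hρ'.1) (sum_kraus_posSemidef L₂ hσ'.1), div_mul_div_comm]
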